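/- Let s be a complex number with s ≠ 1, and define γ_0 = 1/(s−1) and γ_μ = (−1)^μ (s)_{μ−1} B_μ/μ! for μ ≥ 1, where B_μ is the μ-th Bernoulli number. Then for every nonnegative integer μ one has ∑_{λ=0}^{μ} (1−s−μ)_{λ+1} γ_{μ−λ}/(λ+1)! = −δ_{μ0}, i.e., the expression equals −1 for μ = 0 and equals 0 for every μ ≥ 1. -/

import Mathlib

open Polynomial Finset

/-- Reflection formula `(-(x + n))_{n+1} = (-1)^{n+1} (x)_{n+1}`. -/
theorem ascPochhammer_eval_neg_add {R : Type*} [CommRing R] (x : R) (n : ℕ) :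
    (ascPochhammer R (n + 1)).eval (-(x + n)) =
      (-1) ^ (n + 1) * (ascPochhammer R (n + 1)).eval x := by
  rw [ascPochhammer_eval_neg_eq_descPochhammer, descPochhammer_eval_eq_ascPochhammer]
  congr 2
  push_cast
  ring

/-- Splitting formula `(x)_m (x + m)_n = (x)_{m+n}`. -/
theorem ascPochhammer_eval_mul_eval_add {R : Type*} [CommSemiring R] (x : R) (m n : ℕ) :
    (ascPochhammer R m).eval x * (ascPochhammer R n).eval (x + m) =
      (ascPochhammer R (m + n)).eval x := by
  rw [← ascPochhammer_mul]
  simp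

/-- Peeling off the first factor: `(x)_{n+1} = x (x + 1)_n`. -/
theorem ascPochhammer_eval_succ_left {R : Type*} [CommSemiring R] (x : R) (n : ℕ) :
    (ascPochhammer R (n + 1)).eval x = x * (ascPochhammer R n).eval (x + 1) := by
  simp [ascPochhammer_succ_left]

theorem zeta_linear_system_bernoulli_solution (s : ℂ) (hs : s ≠ 1) (γ : ℕ → ℂ)
    (hγ0 : γ 0 = 1 / (s - 1))
    (hγ : ∀ μ : ℕ, 1 ≤ μ →
      γ μ = (-1 : ℂ) ^ μ * (ascPochhammer ℂ (μ - 1)).eval s * (bernoulli μ : ℂ)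
              / (Nat.factorial μ)) :
    ∀ μ : ℕ,
      ∑ lam ∈ Finset.range (μ + 1),
          (ascPochhammer ℂ (lam + 1)).eval (1 - s - (μ : ℂ)) * γ (μ - lam)
            / (Nat.factorial (lam + 1))
        = if μ = 0 then -1 else 0 := by
  intro μ
  have ht : s - 1 ≠ 0 := sub_ne_zero.mpr hs
  have hγ' (k : ℕ) : γ k = (-1) ^ k * (ascPochhammer ℂ k).eval (s - 1) / (s - 1)
      * (_root_.bernoulli k : ℂ) / k.factorial := by
    cases k with
    | zero => simp [hγ0]
    | succ k =>
      rw [hγ (k + 1) k.succ_pos, ascPochhammer_eval_succ_left, sub_add_cancel, Nat.add_sub_cancel]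
      field_simp
  have hterm (l : ℕ) (hl : l ∈ range (μ + 1)) :
      (ascPochhammer ℂ (l + 1)).eval (1 - s - (μ : ℂ)) * γ (μ - l) / (Nat.factorial (l + 1)) =
        (-1) ^ (μ + 1) * (ascPochhammer ℂ μ).eval s / (μ + 1).factorial
          * ((μ + 1).choose (μ - l) * (_root_.bernoulli (μ - l) : ℂ)) := by
    obtain ⟨k, rfl⟩ := Nat.exists_eq_add_of_le' (Nat.lt_succ_iff.mp (mem_range.mp hl))
    have harg : 1 - s - ((k + l : ℕ) : ℂ) = -((s - 1 + k) + l) := by push_cast; ring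
    have hsplit := ascPochhammer_eval_mul_eval_add (s - 1) k (l + 1)
    rw [← add_assoc, ascPochhammer_eval_succ_left (s - 1) (k + l), sub_add_cancel] at hsplit
    have hpoch : (ascPochhammer ℂ (k + l)).eval s = (ascPochhammer ℂ k).eval (s - 1)
        * (ascPochhammer ℂ (l + 1)).eval (s - 1 + k) / (s - 1) := by
      rw [hsplit, mul_div_cancel_left₀ _ ht]
    rw [Nat.add_sub_cancel, harg, ascPochhammer_eval_neg_add, hγ', hpoch, add_assoc k l 1,
      Nat.cast_add_choose]
    have := Nat.factorial_ne_zero (k + (l + 1))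
    field_simp
    ring
  have hsum : ∑ k ∈ range (μ + 1), ((μ + 1).choose k * (_root_.bernoulli k : ℂ)) =
      if μ = 0 then 1 else 0 := by
    have h := congrArg (Rat.cast : ℚ → ℂ) (sum_bernoulli (μ + 1))
    push_cast at h
    simpa [apply_ite (Rat.cast : ℚ → ℂ)] using h
  rw [sum_congr rfl hterm, ← mul_sum,
    sum_flip (fun k => ((μ + 1).choose k * (_root_.bernoulli k : ℂ))), hsum]
  split_ifs with h
  · simp [h]
  · simp
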